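/- arXiv:2101.08634 — 6 statements merged into one kernel-verified Lean document; each statement's English description precedes it below -/
import Mathlib

section
/- Let H and K be complex Hilbert spaces, n a natural number, and a, b : Fin n → B(H,K) finite families of bounded operators. Let h := (Σ_{i} a_i* a_i)^{1/2} and k := (Σ_{i} b_i* b_i)^{1/2} be the positive square roots (via continuous functional calculus) of the positive operators Σ_i a_i* a_i and Σ_i b_i* b_i on H. Then there exists an operator c ∈ B(H) with ‖c‖ ≤ 1 such that Σ_{i} b_i* a_i = k c h. -/
open ContinuousLinearMap in
/-- Douglas factorization lemma: an operator dominated in norm by `g` factors through `g` via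
a contraction. -/
theorem exists_contraction_comp_eq {𝕜 E F G : Type*} [RCLike 𝕜]
    [AddCommGroup E] [Module 𝕜 E] [TopologicalSpace E]
    [NormedAddCommGroup F] [InnerProductSpace 𝕜 F] [CompleteSpace F]
    [NormedAddCommGroup G] [NormedSpace 𝕜 G] [CompleteSpace G]
    (f : E →L[𝕜] G) (g : E →L[𝕜] F) (hfg : ∀ x, ‖f x‖ ≤ ‖g x‖) :
    ∃ u : F →L[𝕜] G, ‖u‖ ≤ 1 ∧ u ∘L g = f := by
  let S : Submodule 𝕜 F := g.range.topologicalClosure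
  have : CompleteSpace S := g.range.isClosed_topologicalClosure.completeSpace_coe
  have hmem : ∀ x, g x ∈ S := fun x => g.range.le_topologicalClosure ⟨x, rfl⟩
  let e : E →ₗ[𝕜] S := (g : E →ₗ[𝕜] F).codRestrict S hmem
  have he : DenseRange e := by
    rw [DenseRange, Subtype.dense_iff]
    intro y hy
    rw [← Set.range_comp]
    exact hy
  have hbound : ∀ x, ‖(f : E →ₗ[𝕜] G) x‖ ≤ 1 * ‖e x‖ := fun x => by
    rw [one_mul]
    exact hfg x
  refine ⟨(f : E →ₗ[𝕜] G).extendOfNorm e ∘L S.orthogonalProjectionOnto, ?_, ?_⟩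
  · exact (opNorm_comp_le _ _).trans <| mul_le_one₀
      (LinearMap.opNorm_extendOfNorm_le he zero_le_one hbound) (norm_nonneg _)
      S.orthogonalProjectionOnto_norm_le
  · ext x
    have hx : S.orthogonalProjectionOnto (g x) = e x :=
      S.orthogonalProjectionOnto_mem_subspace_eq_self (e x)
    rw [comp_apply, comp_apply, hx]
    exact LinearMap.extendOfNorm_eq he ⟨1, hbound⟩ x

open ContinuousLinearMap in
/-- Polar decomposition: an operator `A` factors through `(A* A)^{1/2}` via a contraction. -/
theorem exists_contraction_comp_sqrt_eq {H K : Type*}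
    [NormedAddCommGroup H] [InnerProductSpace ℂ H] [CompleteSpace H]
    [NormedAddCommGroup K] [InnerProductSpace ℂ K] [CompleteSpace K] (A : H →L[ℂ] K) :
    ∃ u : H →L[ℂ] K, ‖u‖ ≤ 1 ∧ u ∘L CFC.sqrt (adjoint A ∘L A) = A := by
  have hpos : 0 ≤ adjoint A ∘L A :=
    (nonneg_iff_isPositive _).2 (isPositive_adjoint_comp_self A)
  have hsa : adjoint (CFC.sqrt (adjoint A ∘L A)) = CFC.sqrt (adjoint A ∘L A) :=
    (IsSelfAdjoint.of_nonneg (CFC.sqrt_nonneg _)).star_eq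
  have hsq : adjoint (CFC.sqrt (adjoint A ∘L A)) ∘L CFC.sqrt (adjoint A ∘L A) =
      adjoint A ∘L A := by
    rw [hsa]
    exact CFC.sqrt_mul_sqrt_self _ hpos
  refine exists_contraction_comp_eq A _ fun x => le_of_eq ?_
  rw [apply_norm_eq_sqrt_inner_adjoint_left A, apply_norm_eq_sqrt_inner_adjoint_left, hsq]

/-- The column operator `x ↦ (aᵢ x)ᵢ` into the `ℓ²`-direct sum. -/
noncomputable def columnOperator {𝕜 ι H K : Type*} [RCLike 𝕜] [Fintype ι]
    [NormedAddCommGroup H] [InnerProductSpace 𝕜 H]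
    [NormedAddCommGroup K] [InnerProductSpace 𝕜 K] (a : ι → H →L[𝕜] K) :
    H →L[𝕜] PiLp 2 fun _ : ι => K :=
  ((PiLp.continuousLinearEquiv 2 𝕜 fun _ : ι => K).symm : (ι → K) →L[𝕜] _) ∘L
    ContinuousLinearMap.pi a

open ContinuousLinearMap in
theorem adjoint_columnOperator_comp {𝕜 ι H K : Type*} [RCLike 𝕜] [Fintype ι]
    [NormedAddCommGroup H] [InnerProductSpace 𝕜 H] [CompleteSpace H]
    [NormedAddCommGroup K] [InnerProductSpace 𝕜 K] [CompleteSpace K] (a b : ι → H →L[𝕜] K) :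
    adjoint (columnOperator b) ∘L columnOperator a = ∑ i, adjoint (b i) ∘L a i := by
  ext x
  refine ext_inner_left 𝕜 fun y => ?_
  simp [columnOperator, adjoint_inner_right, PiLp.inner_apply, inner_sum, sum_apply]

/-- Polar-decomposition form of the operator Cauchy–Schwarz inequality: for finite families
`a, b : Fin n → B(H,K)`, with `h = (Σ aᵢ* aᵢ)^{1/2}` and `k = (Σ bᵢ* bᵢ)^{1/2}` there is a
contraction `c ∈ B(H)` with `Σ bᵢ* aᵢ = k c h`. -/
theorem sum_adjoint_comp_eq_sqrt_contraction_sqrt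
    {H K : Type*} [NormedAddCommGroup H] [InnerProductSpace ℂ H] [CompleteSpace H]
    [NormedAddCommGroup K] [InnerProductSpace ℂ K] [CompleteSpace K]
    (n : ℕ) (a b : Fin n → (H →L[ℂ] K)) :
    ∃ c : H →L[ℂ] H, ‖c‖ ≤ 1 ∧
      (∑ i, (ContinuousLinearMap.adjoint (b i)) ∘L (a i)) =
        CFC.sqrt (∑ i, (ContinuousLinearMap.adjoint (b i)) ∘L (b i)) ∘L c ∘L
          CFC.sqrt (∑ i, (ContinuousLinearMap.adjoint (a i)) ∘L (a i)) := by
  rw [← adjoint_columnOperator_comp a b, ← adjoint_columnOperator_comp a a,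
    ← adjoint_columnOperator_comp b b]
  generalize columnOperator a = A
  generalize columnOperator b = B
  obtain ⟨u, hu, hA⟩ := exists_contraction_comp_sqrt_eq A
  obtain ⟨v, hv, hB⟩ := exists_contraction_comp_sqrt_eq B
  have hsa : ContinuousLinearMap.adjoint (CFC.sqrt (ContinuousLinearMap.adjoint B ∘L B)) =
      CFC.sqrt (ContinuousLinearMap.adjoint B ∘L B) :=
    (IsSelfAdjoint.of_nonneg (CFC.sqrt_nonneg _)).star_eq
  refine ⟨ContinuousLinearMap.adjoint v ∘L u, ?_, ?_⟩
  · refine (ContinuousLinearMap.opNorm_comp_le _ _).trans (mul_le_one₀ ?_ (norm_nonneg _) hu)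
    rwa [LinearIsometryEquiv.norm_map]
  · calc ContinuousLinearMap.adjoint B ∘L A
        = ContinuousLinearMap.adjoint (v ∘L CFC.sqrt (ContinuousLinearMap.adjoint B ∘L B)) ∘L
            (u ∘L CFC.sqrt (ContinuousLinearMap.adjoint A ∘L A)) := by rw [hA, hB]
      _ = _ := by
        rw [ContinuousLinearMap.adjoint_comp, hsa]
        simp only [ContinuousLinearMap.comp_assoc]
end

section
/- Let B be a C*-algebra, H a complex Hilbert space, and π : B → B(H) a linear map that is completely positive and faithful. Then for every b ∈ B one has ‖b‖ = ( sup { ‖π(x* b* b x)‖ : x ∈ B, ‖π(x* x)‖ ≤ 1 } )^{1/2}. -/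
open scoped InnerProductSpace ComplexOrder

/-- A linear map `π : B → B(H)` is completely positive if, for every `n`, applying `π`
entrywise to a positive `n × n` matrix over `B` (i.e. one of the form `Nᴴ * N`) yields a
positive operator on `Hⁿ`, expressed via positivity of the associated quadratic form. -/
def IsCompletelyPositiveMap {B : Type*} [NonUnitalCStarAlgebra B]
    {H : Type*} [NormedAddCommGroup H] [InnerProductSpace ℂ H]
    (π : B →ₗ[ℂ] (H →L[ℂ] H)) : Prop :=
  ∀ (n : ℕ) (M : Matrix (Fin n) (Fin n) B),
    (∃ N : Matrix (Fin n) (Fin n) B, M = N.conjTranspose * N) →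
    ∀ ξ : Fin n → H, 0 ≤ ∑ i, ∑ j, ⟪ξ i, (π (M i j)) (ξ j)⟫_ℂ

/-- A linear map `π : B → B(H)` is faithful if it kills no nonzero positive element. -/
def IsFaithfulMap {B : Type*} [NonUnitalCStarAlgebra B] [PartialOrder B] [StarOrderedRing B]
    {H : Type*} [NormedAddCommGroup H] [InnerProductSpace ℂ H]
    (π : B →ₗ[ℂ] (H →L[ℂ] H)) : Prop :=
  ∀ b : B, 0 ≤ b → π b = 0 → b = 0

theorem LinearMap.norm_map_real_smul {E F : Type*} [AddCommGroup E] [Module ℂ E]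
    [NormedAddCommGroup F] [NormedSpace ℂ F] (f : E →ₗ[ℂ] F) (r : ℝ) (x : E) :
    ‖f (r • x)‖ = |r| * ‖f x‖ := by
  rw [f.map_smul_of_tower, norm_smul, Real.norm_eq_abs]

section

variable {B : Type*} [NonUnitalCStarAlgebra B] [PartialOrder B] [StarOrderedRing B]

/-- An element `a ≥ 0` with `r < ‖a‖` is bounded below by `r` after compressing by a suitable
nonzero element, obtained by functional calculus from the part of the spectrum above `r`. -/
theorem exists_ne_zero_smul_star_mul_self_le_conjugate {a : B} (ha : 0 ≤ a) {r : ℝ} (hr : 0 ≤ r)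
    (hra : r < ‖a‖) : ∃ x : B, x ≠ 0 ∧ r • (star x * x) ≤ star x * a * x := by
  have hsa : IsSelfAdjoint a := .of_nonneg ha
  let f : ℝ → ℝ := fun t => max 0 (t - r)
  have hf : Continuous f := by fun_prop
  have hf0 : f 0 = 0 := by simp [f, hr]
  have hstar : star (cfcₙ f a) = cfcₙ f a := (cfcₙ_predicate f a : IsSelfAdjoint (cfcₙ f a)).star_eq
  refine ⟨cfcₙ f a, fun h => hra.not_ge ?_, ?_⟩
  · rw [← cfcₙ_id' ℝ a]
    refine norm_cfcₙ_le fun t ht => ?_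
    have hft := norm_apply_le_norm_cfcₙ f a ht hf.continuousOn hf0
    rw [h, norm_zero, norm_le_zero_iff] at hft
    rw [Real.norm_of_nonneg (quasispectrum_nonneg_of_nonneg a ha t ht)]
    exact sub_nonpos.1 (max_eq_left_iff.1 hft)
  · rw [hstar]
    have hcompress : cfcₙ f a * a * cfcₙ f a = cfcₙ (fun t => f t * t * f t) a := by
      rw [cfcₙ_mul (fun t => f t * t) f a (by fun_prop) (by simp) hf.continuousOn hf0,
        cfcₙ_mul f (fun t => t) a hf.continuousOn hf0, cfcₙ_id' ℝ a]
    have hsmul : r • (cfcₙ f a * cfcₙ f a) = cfcₙ (fun t => r * (f t * f t)) a := by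
      rw [cfcₙ_const_mul r (fun t => f t * f t) a (by fun_prop) (by simp [hf0]),
        cfcₙ_mul f f a hf.continuousOn hf0 hf.continuousOn hf0]
    rw [hcompress, hsmul]
    refine cfcₙ_mono (fun t _ => ?_) (by fun_prop) (by fun_prop) (by simp [hf0]) (by simp [hf0])
    rcases le_total t r with h | h
    · simp [f, h]
    · nlinarith [mul_nonneg (sub_nonneg.2 h) (mul_self_nonneg (f t))]

variable {H : Type*} [NormedAddCommGroup H] [InnerProductSpace ℂ H] {π : B →ₗ[ℂ] (H →L[ℂ] H)}

theorem IsCompletelyPositiveMap.map_nonneg (hcp : IsCompletelyPositiveMap π) {b : B}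
    (hb : 0 ≤ b) : 0 ≤ π b := by
  obtain ⟨s, rfl⟩ := CStarAlgebra.nonneg_iff_eq_star_mul_self.1 hb
  rw [ContinuousLinearMap.nonneg_iff_isPositive, ContinuousLinearMap.isPositive_iff_complex]
  intro ξ
  have h : 0 ≤ ⟪ξ, π (star s * s) ξ⟫_ℂ := by
    simpa [Matrix.mul_apply] using
      hcp 1 _ ⟨Matrix.of fun _ _ => s, rfl⟩ fun _ => ξ
  rw [← inner_conj_symm, Complex.conj_eq_iff_im.2 (Complex.nonneg_iff.1 h).2.symm]
  exact ⟨Complex.ext rfl (Complex.nonneg_iff.1 h).2, (Complex.nonneg_iff.1 h).1⟩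

theorem IsCompletelyPositiveMap.norm_map_le_norm_map [CompleteSpace H]
    (hcp : IsCompletelyPositiveMap π) {a b : B} (ha : 0 ≤ a) (hab : a ≤ b) : ‖π a‖ ≤ ‖π b‖ := by
  refine CStarAlgebra.norm_le_norm_of_nonneg_of_le (hcp.map_nonneg ha) (sub_nonneg.1 ?_)
  rw [← map_sub]
  exact hcp.map_nonneg (sub_nonneg.2 hab)

end

/-- For a completely positive faithful map `π` on a C*-algebra `B`,
`‖b‖ = (sup {‖π(x* b* b x)‖ : ‖π(x* x)‖ ≤ 1})^{1/2}`. -/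
theorem norm_eq_sqrt_sSup_of_completely_positive_faithful
    {B : Type*} [NonUnitalCStarAlgebra B] [PartialOrder B] [StarOrderedRing B]
    {H : Type*} [NormedAddCommGroup H] [InnerProductSpace ℂ H] [CompleteSpace H]
    (π : B →ₗ[ℂ] (H →L[ℂ] H))
    (hcp : IsCompletelyPositiveMap π) (hfaithful : IsFaithfulMap π) (b : B) :
    ‖b‖ = Real.sqrt (sSup ((fun x => ‖π (star x * star b * b * x)‖) ''
      {x : B | ‖π (star x * x)‖ ≤ 1})) := by
  set S := (fun x => ‖π (star x * star b * b * x)‖) '' {x : B | ‖π (star x * x)‖ ≤ 1}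
  have hbound : ∀ y ∈ S, y ≤ ‖b‖ ^ 2 := by
    rintro _ ⟨x, hx, rfl⟩
    have hle : star x * (star b * b) * x ≤ ‖star b * b‖ • (star x * x) :=
      CStarAlgebra.star_left_conjugate_le_norm_smul (.star_mul_self b)
    have h := hcp.norm_map_le_norm_map (star_left_conjugate_nonneg (star_mul_self_nonneg b) x) hle
    rw [π.norm_map_real_smul, abs_norm, CStarRing.norm_star_mul_self, ← mul_assoc, ← sq] at h
    exact h.trans (mul_le_of_le_one_right (sq_nonneg _) hx)
  have hmem : (0 : ℝ) ∈ S := ⟨0, by simp, by simp⟩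
  have hsup_nonneg : 0 ≤ sSup S := le_csSup ⟨_, hbound⟩ hmem
  rw [eq_comm, Real.sqrt_eq_iff_mul_self_eq hsup_nonneg (norm_nonneg b), ← sq]
  refine le_antisymm (csSup_le ⟨0, hmem⟩ hbound) (le_of_forall_lt_imp_le_of_dense fun r hr => ?_)
  rcases lt_or_ge r 0 with hr0 | hr0
  · exact hr0.le.trans hsup_nonneg
  obtain ⟨x, hx, hle⟩ := exists_ne_zero_smul_star_mul_self_le_conjugate
    (star_mul_self_nonneg b) hr0 (by rwa [CStarRing.norm_star_mul_self, ← sq])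
  have hpos : 0 < ‖π (star x * x)‖ := norm_pos_iff.2 fun h =>
    hx (CStarRing.star_mul_self_eq_zero_iff x |>.1 (hfaithful _ (star_mul_self_nonneg x) h))
  set p := ‖π (star x * x)‖
  have hscale : |(√p)⁻¹ * (√p)⁻¹| = p⁻¹ := by
    rw [← mul_inv, Real.mul_self_sqrt hpos.le, abs_of_pos (inv_pos.2 hpos)]
  have hnorm : r * p ≤ ‖π (star x * star b * b * x)‖ := by
    have h := hcp.norm_map_le_norm_map (smul_nonneg hr0 (star_mul_self_nonneg x)) hle
    rwa [π.norm_map_real_smul, abs_of_nonneg hr0, ← mul_assoc] at h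
  have hconj : ‖π (star ((√p)⁻¹ • x) * star b * b * ((√p)⁻¹ • x))‖
      = p⁻¹ * ‖π (star x * star b * b * x)‖ := by
    simp only [star_smul, star_trivial, smul_mul_assoc, mul_smul_comm, smul_smul,
      π.norm_map_real_smul, hscale]
  refine le_csSup_of_le ⟨_, hbound⟩ ⟨(√p)⁻¹ • x, ?_, hconj⟩ ?_
  · simp only [Set.mem_ofPred_eq, star_smul, star_trivial, smul_mul_assoc, mul_smul_comm,
      smul_smul, π.norm_map_real_smul, hscale]
    exact (inv_mul_cancel₀ hpos.ne').le
  · rwa [inv_mul_eq_div, le_div_iff₀ hpos]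
end

section
/- Let G be a discrete group with a length function |·|, and assume there exist constants C > 0 and s > 0 such that the ball {g ∈ G : |g| ≤ k} has at most C(1+k)^s elements for every integer k ≥ 0 (polynomial growth). Then there exists M > 0, depending only on C and s, such that for every complex Hilbert space H, every norm-closed self-adjoint subalgebra A of B(H), every action α of G on A by *-automorphisms, and every finitely supported X : G → A, both of the following hold: ‖T_X‖ ≤ M · ‖ Σ_{g∈G} (1+|g|)^{s+2} α_g(X(g) X(g)*) ‖^{1/2} and ‖T_X‖ ≤ M · ‖ Σ_{g∈G} (1+|g|)^{s+2} X(g)* X(g) ‖^{1/2}, where the norms on the right-hand sides are operator norms of the (finite) sums in B(H). -/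
/-- A length function on a group `G`. -/
structure IsLengthFunction {G : Type*} [Group G] (ℓ : G → ℝ) : Prop where
  nonneg : ∀ g, 0 ≤ ℓ g
  one : ℓ 1 = 0
  inv : ∀ g, ℓ g⁻¹ = ℓ g
  subadd : ∀ g h, ℓ (g * h) ≤ ℓ g + ℓ h

/-- Under polynomial growth of order `s`, the weights `(1 + ℓ)^(-(s + 2))` are uniformly
summable. -/
theorem sum_inv_weight_le {G : Type*} {ℓ : G → ℝ} (hℓ : ∀ g, 0 ≤ ℓ g) {C s : ℝ} (hC : 0 < C)
    (hs : 0 < s)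
    (hgrowth : ∀ k : ℕ, {g : G | ℓ g ≤ (k : ℝ)}.Finite ∧
      ({g : G | ℓ g ≤ (k : ℝ)}.ncard : ℝ) ≤ C * (1 + (k : ℝ)) ^ s) (S : Finset G) :
    ∑ g ∈ S, ((1 + ℓ g) ^ (s + 2))⁻¹ ≤ C * 2 ^ s * 2 := by
  classical
  set j : G → ℕ := fun g => ⌊ℓ g⌋₊ + 1 with hj
  obtain ⟨n, hn⟩ : ∃ n : ℕ, ∀ g ∈ S, j g < n :=
    ⟨S.sup j + 1, fun g hg => Nat.lt_succ_of_le (Finset.le_sup hg)⟩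
  have hmaps : ∀ g ∈ S, j g ∈ Finset.Ioo 0 n := fun g hg =>
    Finset.mem_Ioo.2 ⟨Nat.succ_pos _, hn g hg⟩
  rw [← Finset.sum_fiberwise_of_maps_to hmaps]
  have key : ∀ i ∈ Finset.Ioo 0 n,
      ∑ g ∈ S with j g = i, ((1 + ℓ g) ^ (s + 2))⁻¹ ≤ C * 2 ^ s * ((i : ℝ) ^ 2)⁻¹ := by
    intro i hi
    have hi1 : (1 : ℝ) ≤ i := by exact_mod_cast (Finset.mem_Ioo.1 hi).1
    have hi0 : (0 : ℝ) < i := by linarith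
    have hterm : ∀ g ∈ S.filter (fun g => j g = i),
        ((1 + ℓ g) ^ (s + 2))⁻¹ ≤ ((i : ℝ) ^ (s + 2))⁻¹ := by
      intro g hg
      have hgi : (i : ℝ) ≤ 1 + ℓ g := by
        rw [← (Finset.mem_filter.1 hg).2, hj]
        push_cast
        linarith [Nat.floor_le (hℓ g)]
      gcongr
    have hcard : ((S.filter (fun g => j g = i)).card : ℝ) ≤ C * (1 + (i : ℝ)) ^ s := by
      refine le_trans ?_ (hgrowth i).2
      rw [← Set.ncard_coe_finset]
      refine Nat.cast_le.2 (Set.ncard_le_ncard ?_ (hgrowth i).1)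
      intro g hg
      have hg' := (Finset.mem_filter.1 (Finset.mem_coe.1 hg)).2
      simp only [Set.mem_ofPred_eq, ← hg', hj]
      push_cast
      exact (Nat.lt_floor_add_one _).le
    calc ∑ g ∈ S with j g = i, ((1 + ℓ g) ^ (s + 2))⁻¹
        ≤ (S.filter (fun g => j g = i)).card * ((i : ℝ) ^ (s + 2))⁻¹ := by
          simpa [nsmul_eq_mul] using Finset.sum_le_card_nsmul _ _ _ hterm
      _ ≤ (C * (1 + (i : ℝ)) ^ s) * ((i : ℝ) ^ (s + 2))⁻¹ := by gcongr
      _ ≤ (C * (2 * (i : ℝ)) ^ s) * ((i : ℝ) ^ (s + 2))⁻¹ := by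
          gcongr
          linarith
      _ = C * 2 ^ s * ((i : ℝ) ^ 2)⁻¹ := by
          have : (i : ℝ) ^ s ≠ 0 := (Real.rpow_pos_of_pos hi0 s).ne'
          rw [Real.mul_rpow (by norm_num) hi0.le, Real.rpow_add hi0, Real.rpow_two]
          field_simp
  refine (Finset.sum_le_sum key).trans ?_
  rw [← Finset.mul_sum]
  have := sum_Ioo_inv_sq_le (α := ℝ) 0 n
  norm_num at this
  gcongr

section Weighted

variable {ι H : Type*} [NormedAddCommGroup H]

theorem sum_weight_mul_norm_sq_le [InnerProductSpace ℂ H] [CompleteSpace H] (S : Finset ι)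
    (w : ι → ℝ)
    (Y : ι → H →L[ℂ] H) (v : H) :
    ∑ i ∈ S, w i * ‖Y i v‖ ^ 2 ≤ ‖∑ i ∈ S, (w i : ℂ) • (star (Y i) * Y i)‖ * ‖v‖ ^ 2 := by
  have h : ∑ i ∈ S, w i * ‖Y i v‖ ^ 2 =
      RCLike.re (inner ℂ v ((∑ i ∈ S, (w i : ℂ) • (star (Y i) * Y i)) v)) := by
    simp only [sum_apply, inner_sum, map_sum]
    refine Finset.sum_congr rfl fun i _ => ?_
    rw [smul_apply, inner_smul_right, mul_apply_eq_comp,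
      ContinuousLinearMap.star_eq_adjoint, ContinuousLinearMap.adjoint_inner_right,
      inner_self_eq_norm_sq_to_K]
    change _ = ((w i : ℂ) * ((‖Y i v‖ : ℝ) : ℂ) ^ 2).re
    norm_cast
  rw [h]
  refine (RCLike.re_le_norm _).trans ((norm_inner_le_norm _ _).trans ?_)
  calc ‖v‖ * ‖(∑ i ∈ S, (w i : ℂ) • (star (Y i) * Y i)) v‖
      ≤ ‖v‖ * (‖∑ i ∈ S, (w i : ℂ) • (star (Y i) * Y i)‖ * ‖v‖) := by
        gcongr
        exact ContinuousLinearMap.le_opNorm _ _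
    _ = _ := by ring

theorem sq_sum_mul_le_weighted (S : Finset ι) {w : ι → ℝ} (hw : ∀ i, 0 < w i) (a b : ι → ℝ) :
    (∑ i ∈ S, a i * b i) ^ 2 ≤ (∑ i ∈ S, (w i)⁻¹ * a i ^ 2) * ∑ i ∈ S, w i * b i ^ 2 := by
  refine Finset.sum_sq_le_sum_mul_sum_of_sq_le_mul S
    (fun i _ => mul_nonneg (inv_nonneg.2 (hw i).le) (sq_nonneg _))
    (fun i _ => mul_nonneg (hw i).le (sq_nonneg _)) fun i _ => ?_
  have := (hw i).ne'
  exact le_of_eq (by field_simp)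

theorem norm_sum_sq_le_weighted (S : Finset ι) {w : ι → ℝ} (hw : ∀ i, 0 < w i) (u : ι → H) :
    ‖∑ i ∈ S, u i‖ ^ 2 ≤ (∑ i ∈ S, (w i)⁻¹) * ∑ i ∈ S, w i * ‖u i‖ ^ 2 := by
  have h := sq_sum_mul_le_weighted S hw (fun _ => 1) (fun i => ‖u i‖)
  simp only [one_mul, one_pow, mul_one] at h
  refine le_trans ?_ h
  gcongr
  exact norm_sum_le _ _

theorem norm_sum_apply_sq_le_weighted [InnerProductSpace ℂ H] [CompleteSpace H] (S : Finset ι)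
    {w : ι → ℝ}
    (hw : ∀ i, 0 < w i) (Y : ι → H →L[ℂ] H) (u : ι → H) :
    ‖∑ i ∈ S, Y i (u i)‖ ^ 2 ≤
      ‖∑ i ∈ S, (w i : ℂ) • (Y i * star (Y i))‖ * ∑ i ∈ S, (w i)⁻¹ * ‖u i‖ ^ 2 := by
  set v := ∑ i ∈ S, Y i (u i) with hv
  set N := ‖∑ i ∈ S, (w i : ℂ) • (Y i * star (Y i))‖ with hN
  have h1 : ‖v‖ ^ 2 ≤ ∑ i ∈ S, ‖u i‖ * ‖star (Y i) v‖ := by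
    have : ‖v‖ ^ 2 = ∑ i ∈ S, RCLike.re (inner ℂ (u i) (star (Y i) v)) := by
      rw [← inner_self_eq_norm_sq (𝕜 := ℂ) v]
      nth_rewrite 1 [hv]
      rw [sum_inner, map_sum]
      refine Finset.sum_congr rfl fun i _ => ?_
      rw [ContinuousLinearMap.star_eq_adjoint, ContinuousLinearMap.adjoint_inner_right]
    rw [this]
    exact Finset.sum_le_sum fun i _ =>
      (RCLike.re_le_norm _).trans (norm_inner_le_norm _ _)
  have h2 := sq_sum_mul_le_weighted S hw (fun i => ‖u i‖) (fun i => ‖star (Y i) v‖)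
  have h3 : ∑ i ∈ S, w i * ‖star (Y i) v‖ ^ 2 ≤ N * ‖v‖ ^ 2 := by
    simpa only [star_star] using sum_weight_mul_norm_sq_le S w (fun i => star (Y i)) v
  have h4 : 0 ≤ ∑ i ∈ S, (w i)⁻¹ * ‖u i‖ ^ 2 :=
    Finset.sum_nonneg fun i _ => mul_nonneg (inv_nonneg.2 (hw i).le) (sq_nonneg _)
  have h5 : ‖v‖ ^ 2 * ‖v‖ ^ 2 ≤ (N * ∑ i ∈ S, (w i)⁻¹ * ‖u i‖ ^ 2) * ‖v‖ ^ 2 := by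
    calc ‖v‖ ^ 2 * ‖v‖ ^ 2 = (‖v‖ ^ 2) ^ 2 := by ring
      _ ≤ (∑ i ∈ S, ‖u i‖ * ‖star (Y i) v‖) ^ 2 := by gcongr
      _ ≤ _ := h2
      _ ≤ (∑ i ∈ S, (w i)⁻¹ * ‖u i‖ ^ 2) * (N * ‖v‖ ^ 2) := by gcongr
      _ = _ := by ring
  rcases (sq_nonneg ‖v‖).eq_or_lt with h0 | h0
  · rw [← h0]
    exact mul_nonneg (norm_nonneg _) h4
  · exact le_of_mul_le_mul_right h5 h0

theorem lp_two_hasSum_norm_sq (ξ : lp (fun _ : ι => H) 2) :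
    HasSum (fun i => ‖(ξ : ∀ _ : ι, H) i‖ ^ 2) (‖ξ‖ ^ 2) := by
  simpa using lp.hasSum_norm (p := 2) (by norm_num) ξ

end Weighted

/-- An operator on `ℓ²(G, H)` whose values are controlled by a finite family of nonnegative
functions, composed with left translations, is bounded accordingly. -/
theorem norm_le_sqrt_of_translate_bound {G H : Type*} [Group G] [NormedAddCommGroup H]
    [InnerProductSpace ℂ H] (T : lp (fun _ : G => H) 2 →L[ℂ] lp (fun _ : G => H) 2)
    (S : Finset G) (f : G → G → H → ℝ) (hf : ∀ g k v, 0 ≤ f g k v) {c : ℝ} (hc : 0 ≤ c)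
    (hfc : ∀ k v, ∑ g ∈ S, f g k v ≤ c * ‖v‖ ^ 2)
    (hT : ∀ (ξ : lp (fun _ : G => H) 2) (h : G), ‖(T ξ : ∀ _ : G, H) h‖ ^ 2 ≤
      ∑ g ∈ S, f g (g⁻¹ * h) ((ξ : ∀ _ : G, H) (g⁻¹ * h))) :
    ‖T‖ ≤ Real.sqrt c := by
  refine T.opNorm_le_bound (Real.sqrt_nonneg _) fun ξ => ?_
  have hξ := lp_two_hasSum_norm_sq ξ
  have hsum : ∀ g ∈ S, Summable fun k => f g k ((ξ : ∀ _ : G, H) k) := fun g hg =>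
    Summable.of_nonneg_of_le (fun k => hf _ _ _)
      (fun k => (Finset.single_le_sum (fun i _ => hf i k _) hg).trans (hfc k _))
      (hξ.summable.mul_left c)
  have htrans : ∀ g ∈ S, HasSum (fun h => f g (g⁻¹ * h) ((ξ : ∀ _ : G, H) (g⁻¹ * h)))
      (∑' k, f g k ((ξ : ∀ _ : G, H) k)) := fun g hg =>
    (Equiv.mulLeft g⁻¹).hasSum_iff.2 (hsum g hg).hasSum
  have h1 : ‖T ξ‖ ^ 2 ≤ ∑ g ∈ S, ∑' k, f g k ((ξ : ∀ _ : G, H) k) :=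
    hasSum_le (hT ξ) (lp_two_hasSum_norm_sq (T ξ)) (hasSum_sum htrans)
  have h2 : ∑ g ∈ S, ∑' k, f g k ((ξ : ∀ _ : G, H) k) ≤ c * ‖ξ‖ ^ 2 :=
    hasSum_le (fun k => hfc k _) (hasSum_sum fun g hg => (hsum g hg).hasSum) (hξ.mul_left c)
  refine le_of_sq_le_sq ?_ (by positivity)
  rw [mul_pow, Real.sq_sqrt hc]
  exact h1.trans h2

theorem starAlgEquiv_map_star {R A B : Type*} [Add A] [Mul A] [SMul R A] [Star A] [Add B] [Mul B]
    [SMul R B] [Star B] (φ : A ≃⋆ₐ[R] B) (x : A) : φ (star x) = star (φ x) :=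
  map_star φ x

theorem coe_map_star_mul {H : Type*} [NormedAddCommGroup H] [InnerProductSpace ℂ H]
    [CompleteSpace H] {A : NonUnitalStarSubalgebra ℂ (H →L[ℂ] H)} (φ : A ≃⋆ₐ[ℂ] A) (x : A) :
    (φ (star x * x) : H →L[ℂ] H) = star (φ x : H →L[ℂ] H) * φ x := by
  rw [map_mul, starAlgEquiv_map_star φ x]
  rfl

theorem coe_map_mul_star {H : Type*} [NormedAddCommGroup H] [InnerProductSpace ℂ H]
    [CompleteSpace H] {A : NonUnitalStarSubalgebra ℂ (H →L[ℂ] H)} (φ : A ≃⋆ₐ[ℂ] A) (x : A) :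
    (φ (x * star x) : H →L[ℂ] H) = φ x * star (φ x : H →L[ℂ] H) := by
  rw [map_mul, starAlgEquiv_map_star φ x]
  rfl

/-- The weighted sums of a family in a concrete C*-algebra have the same norm after applying
a *-automorphism to each term. -/
theorem norm_sum_smul_map {ι H : Type*} [NormedAddCommGroup H] [InnerProductSpace ℂ H]
    [CompleteSpace H] {A : NonUnitalStarSubalgebra ℂ (H →L[ℂ] H)}
    (hA : IsClosed (A : Set (H →L[ℂ] H))) (φ : A ≃⋆ₐ[ℂ] A) (S : Finset ι) (w : ι → ℂ)
    (Z : ι → A) :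
    ‖∑ i ∈ S, w i • (φ (Z i) : H →L[ℂ] H)‖ = ‖∑ i ∈ S, w i • (Z i : H →L[ℂ] H)‖ := by
  have : IsClosed (A : Set (H →L[ℂ] H)) := hA
  have h : ‖φ (∑ i ∈ S, w i • Z i)‖ = ‖∑ i ∈ S, w i • Z i‖ := StarAlgEquiv.norm_map φ _
  simpa [map_sum, map_smul] using h

/-- Complete operator rapid decay for reduced crossed products by a group of polynomial
growth: if `|{g : |g| ≤ k}| ≤ C(1+k)^s` for all integers `k ≥ 0`, then there is `M > 0`
(depending only on `C` and `s`) such that for every action `α` of `G` by *-automorphisms on a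
norm-closed self-adjoint subalgebra `A ⊆ B(H)` and every finitely supported `X : G → A`, the
operator `T_X` on `ℓ²(G,H)` (representing `Σ_g L_g X(g)` in `C*_r(A ⋊_α G)`) satisfies
`‖T_X‖ ≤ M ‖Σ_g (1+|g|)^{s+2} α_g(X(g)X(g)*)‖^{1/2}` and
`‖T_X‖ ≤ M ‖Σ_g (1+|g|)^{s+2} X(g)*X(g)‖^{1/2}`. -/
theorem polynomial_growth_complete_operator_rapid_decay (C s : ℝ) (hC : 0 < C) (hs : 0 < s) :
    ∃ M : ℝ, 0 < M ∧
      ∀ (G : Type*) [Group G] (ℓ : G → ℝ), IsLengthFunction ℓ →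
        (∀ k : ℕ, {g : G | ℓ g ≤ (k : ℝ)}.Finite ∧
          ({g : G | ℓ g ≤ (k : ℝ)}.ncard : ℝ) ≤ C * (1 + (k : ℝ)) ^ s) →
        ∀ (H : Type*) [NormedAddCommGroup H] [InnerProductSpace ℂ H] [CompleteSpace H]
          (A : NonUnitalStarSubalgebra ℂ (H →L[ℂ] H)),
          IsClosed (A : Set (H →L[ℂ] H)) →
        ∀ α : G → (A ≃⋆ₐ[ℂ] A), (∀ x, α 1 x = x) →
          (∀ g h x, α (g * h) x = α g (α h x)) →
        ∀ (X : G →₀ A) (T : lp (fun _ : G => H) 2 →L[ℂ] lp (fun _ : G => H) 2),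
          (∀ (ξ : lp (fun _ : G => H) 2) (h : G),
            (T ξ : ∀ _ : G, H) h = ∑ g ∈ X.support,
              ((α (h⁻¹ * g) (X g) : H →L[ℂ] H) ((ξ : ∀ _ : G, H) (g⁻¹ * h)))) →
          ‖T‖ ≤ M * Real.sqrt ‖∑ g ∈ X.support,
              ((((1 + ℓ g) ^ (s + 2) : ℝ) : ℂ) •
                ((α g (X g * star (X g)) : H →L[ℂ] H)))‖ ∧
          ‖T‖ ≤ M * Real.sqrt ‖∑ g ∈ X.support,
              ((((1 + ℓ g) ^ (s + 2) : ℝ) : ℂ) •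
                ((star (X g) * X g : A) : H →L[ℂ] H))‖ := by
  refine ⟨Real.sqrt (C * 2 ^ s * 2), by positivity, ?_⟩
  intro G _ ℓ hℓ hgrowth H _ _ _ A hA α _ hmul X T hT
  have hw : ∀ g, 0 < (1 + ℓ g) ^ (s + 2) := fun g =>
    Real.rpow_pos_of_pos (by linarith [hℓ.nonneg g]) _
  have hK := sum_inv_weight_le hℓ.nonneg hC hs hgrowth X.support
  have hKpos : 0 < C * 2 ^ s * 2 := by positivity
  constructor
  · set N := ‖∑ g ∈ X.support, ((((1 + ℓ g) ^ (s + 2) : ℝ) : ℂ) •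
      ((α g (X g * star (X g)) : H →L[ℂ] H)))‖ with hN
    have hN0 : 0 ≤ N := norm_nonneg _
    rw [← Real.sqrt_mul hKpos.le]
    refine norm_le_sqrt_of_translate_bound T X.support
      (fun g _ v => N * (((1 + ℓ g) ^ (s + 2))⁻¹ * ‖v‖ ^ 2)) (fun g k v => ?_)
      (by positivity) (fun k v => ?_) (fun ξ h => ?_)
    · have := (hw g).le
      positivity
    · rw [← Finset.mul_sum, ← Finset.sum_mul]
      calc _ ≤ N * (C * 2 ^ s * 2 * ‖v‖ ^ 2) := by gcongr
        _ = _ := by ring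
    · rw [hT, ← Finset.mul_sum]
      refine (norm_sum_apply_sq_le_weighted X.support hw _ _).trans (le_of_eq ?_)
      congr 1
      rw [hN, ← norm_sum_smul_map hA (α h⁻¹)]
      congr 1
      refine Finset.sum_congr rfl fun g _ => ?_
      rw [← hmul, coe_map_mul_star]
  · set N := ‖∑ g ∈ X.support, ((((1 + ℓ g) ^ (s + 2) : ℝ) : ℂ) •
      ((star (X g) * X g : A) : H →L[ℂ] H))‖ with hN
    have hN0 : 0 ≤ N := norm_nonneg _
    rw [← Real.sqrt_mul hKpos.le]
    refine norm_le_sqrt_of_translate_bound T X.support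
      (fun g k v => C * 2 ^ s * 2 * ((1 + ℓ g) ^ (s + 2) * ‖(α k⁻¹ (X g) : H →L[ℂ] H) v‖ ^ 2))
      (fun g k v => ?_) (by positivity) (fun k v => ?_) (fun ξ h => ?_)
    · have := (hw g).le
      positivity
    · rw [← Finset.mul_sum, mul_assoc _ N]
      refine mul_le_mul_of_nonneg_left ?_ hKpos.le
      refine (sum_weight_mul_norm_sq_le X.support _ _ v).trans (le_of_eq ?_)
      congr 1
      rw [hN, ← norm_sum_smul_map hA (α k⁻¹)]
      congr 1
      refine Finset.sum_congr rfl fun g _ => ?_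
      rw [coe_map_star_mul]
    · rw [hT, ← Finset.mul_sum]
      refine (norm_sum_sq_le_weighted X.support hw _).trans ?_
      simp only [mul_inv_rev, inv_inv]
      refine mul_le_mul_of_nonneg_right hK (Finset.sum_nonneg fun g _ => ?_)
      have := (hw g).le
      positivity
end

section
/- Let F be a free group on a set S, with word length |·|. Then for every complex Hilbert space H, every norm-closed self-adjoint subalgebra A of B(H), every action α of F on A by *-automorphisms, every integer k ≥ 0, and every finitely supported X : F → A whose support is contained in C_k, one has ‖T_X‖ ≤ (k+1) ( Σ_{a∈C_k} ‖X(a)‖² )^{1/2}. -/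
namespace FreeGroup

variable {S : Type*} [DecidableEq S]

/-- The element represented by the first `p` letters of the reduced word of `g`. -/
def takeWord (p : ℕ) (g : FreeGroup S) : FreeGroup S := mk (g.toWord.take p)

/-- The element represented by the reduced word of `g` with its first `p` letters removed. -/
def dropWord (p : ℕ) (g : FreeGroup S) : FreeGroup S := mk (g.toWord.drop p)

theorem takeWord_mul_dropWord (p : ℕ) (g : FreeGroup S) : takeWord p g * dropWord p g = g := by
  simp [takeWord, dropWord, mul_mk, mk_toWord]

theorem toWord_dropWord (p : ℕ) (g : FreeGroup S) :
    (dropWord p g).toWord = g.toWord.drop p := by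
  rw [dropWord, toWord_mk]
  exact (isReduced_toWord.infix (List.drop_suffix p _).isInfix).reduce_eq

/-- No cancellation occurs in the product `g * h`. -/
def MulReduced (g h : FreeGroup S) : Prop := (g * h).toWord = g.toWord ++ h.toWord

/-- The words of `g` and `h` have the same first `p` letters, and nothing else cancels in
`g⁻¹ * h`. -/
def CancelsAt (p : ℕ) (g h : FreeGroup S) : Prop :=
  takeWord p g = takeWord p h ∧ MulReduced (dropWord p g)⁻¹ (dropWord p h)

theorem CancelsAt.inv_mul {p : ℕ} {g h : FreeGroup S} (H : CancelsAt p g h) :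
    g⁻¹ * h = (dropWord p g)⁻¹ * dropWord p h := by
  conv_lhs => rw [← takeWord_mul_dropWord p g, ← takeWord_mul_dropWord p h, H.1]
  group

theorem isReduced_invRev_append {v w : List (S × Bool)} (hv : IsReduced v) (hw : IsReduced w)
    (hvw : ∀ a ∈ v.head?, ∀ b ∈ w.head?, a ≠ b) : IsReduced (invRev v ++ w) := by
  have hv' : IsReduced (invRev v) := by
    rw [isReduced_iff_reduce_eq] at hv ⊢
    rw [reduce_invRev, hv]
  refine List.isChain_append.2 ⟨hv', hw, ?_⟩
  rintro ⟨a, b⟩ hx ⟨c, d⟩ hy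
  rintro (rfl : a = c)
  simp only [invRev, List.getLast?_reverse, List.head?_map, Option.mem_def,
    Option.map_eq_some_iff] at hx
  obtain ⟨⟨a', b'⟩, hz, hab⟩ := hx
  have hne := hvw _ hz _ hy
  simp only [Prod.mk.injEq] at hab
  obtain ⟨rfl, rfl⟩ := hab
  cases b' <;> cases d <;> simp_all

theorem exists_common_prefix {β : Type*} (l m : List β) :
    ∃ p ≤ l.length, l.take p = m.take p ∧
      ∀ a ∈ (l.drop p).head?, ∀ b ∈ (m.drop p).head?, a ≠ b := by
  induction l generalizing m with
  | nil => exact ⟨0, by simp⟩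
  | cons a l ih =>
    rcases m with _ | ⟨b, m⟩
    · exact ⟨0, by simp⟩
    · by_cases hab : a = b
      · obtain ⟨p, hp, h1, h2⟩ := ih m
        exact ⟨p + 1, by simpa using hp, by simp [hab, h1], by simpa using h2⟩
      · exact ⟨0, by simp [hab]⟩

theorem exists_cancelsAt (g h : FreeGroup S) : ∃ p ≤ g.norm, CancelsAt p g h := by
  obtain ⟨p, hp, h1, h2⟩ := exists_common_prefix g.toWord h.toWord
  refine ⟨p, hp, by rw [takeWord, takeWord, h1], ?_⟩
  rw [MulReduced, toWord_mul, toWord_inv, toWord_dropWord, toWord_dropWord]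
  exact (isReduced_invRev_append (isReduced_toWord.infix (List.drop_suffix p _).isInfix)
    (isReduced_toWord.infix (List.drop_suffix p _).isInfix) h2).reduce_eq

theorem MulReduced.inj {v w v' w' : FreeGroup S} (H : MulReduced v w) (H' : MulReduced v' w')
    (hn : v.norm = v'.norm) (he : v * w = v' * w') : v = v' ∧ w = w' := by
  have := congrArg toWord he
  rw [H, H'] at this
  obtain ⟨h1, h2⟩ := List.append_inj this hn
  exact ⟨toWord_injective h1, toWord_injective h2⟩

open Classical in
theorem sum_sq_cancelsAt_le (p k : ℕ) (s E : Finset (FreeGroup S)) (hs : ∀ g ∈ s, g.norm = k)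
    (x η : FreeGroup S → ℝ) (M : ℝ) (hM : ∀ F : Finset (FreeGroup S), ∑ h ∈ F, η h ^ 2 ≤ M) :
    ∑ h ∈ E, (∑ g ∈ s with CancelsAt p g h, x g * η (g⁻¹ * h)) ^ 2 ≤ (∑ g ∈ s, x g ^ 2) * M := by
  set U := (s ∪ E).image (takeWord p)
  set V := s.image (dropWord p)
  set W := E.image (dropWord p)
  set A : FreeGroup S → ℝ := fun u => ∑ g ∈ s with takeWord p g = u, x g ^ 2
  set B : FreeGroup S → ℝ := fun w => ∑ v ∈ V with MulReduced v⁻¹ w, η (v⁻¹ * w) ^ 2 with hB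
  have hA0 : ∀ u, 0 ≤ A u := fun u => Finset.sum_nonneg fun _ _ => sq_nonneg _
  have hB0 : ∀ w, 0 ≤ B w := fun w => Finset.sum_nonneg fun _ _ => sq_nonneg _
  have hVn : ∀ v ∈ V, v⁻¹.norm = k - p := by
    intro v hv
    obtain ⟨g, hg, rfl⟩ := Finset.mem_image.1 hv
    rw [norm_inv_eq, norm, toWord_dropWord, List.length_drop, ← hs g hg, norm]
  have hrow : ∀ h, (∑ g ∈ s with CancelsAt p g h, x g * η (g⁻¹ * h)) ^ 2 ≤
      A (takeWord p h) * B (dropWord p h) := by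
    intro h
    refine (Finset.sum_mul_sq_le_sq_mul_sq _ _ _).trans ?_
    refine mul_le_mul ?_ ?_ (Finset.sum_nonneg fun _ _ => sq_nonneg _) (hA0 _)
    · refine Finset.sum_le_sum_of_subset_of_nonneg ?_ fun _ _ _ => sq_nonneg _
      exact Finset.monotone_filter_right _ fun g _ H => H.1
    · have hinj : Set.InjOn (dropWord p : FreeGroup S → FreeGroup S)
          ({g ∈ s | CancelsAt p g h} : Finset (FreeGroup S)) := by
        intro g hg g' hg' he
        have h1 := (Finset.mem_filter.1 hg).2.1
        have h2 := (Finset.mem_filter.1 hg').2.1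
        rw [← takeWord_mul_dropWord p g, ← takeWord_mul_dropWord p g', h1, h2, he]
      calc ∑ g ∈ s with CancelsAt p g h, η (g⁻¹ * h) ^ 2
          = ∑ g ∈ s with CancelsAt p g h, η ((dropWord p g)⁻¹ * dropWord p h) ^ 2 :=
            Finset.sum_congr rfl fun g hg => by rw [(Finset.mem_filter.1 hg).2.inv_mul]
        _ = ∑ v ∈ ({g ∈ s | CancelsAt p g h} : Finset _).image (dropWord p),
              η (v⁻¹ * dropWord p h) ^ 2 :=
            (Finset.sum_image (f := fun v => η (v⁻¹ * dropWord p h) ^ 2) hinj).symm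
        _ ≤ B (dropWord p h) := by
            refine Finset.sum_le_sum_of_subset_of_nonneg ?_ fun _ _ _ => sq_nonneg _
            intro v hv
            obtain ⟨g, hg, rfl⟩ := Finset.mem_image.1 hv
            obtain ⟨hg, hc⟩ := Finset.mem_filter.1 hg
            exact Finset.mem_filter.2 ⟨Finset.mem_image_of_mem _ hg, hc.2⟩
  have hAs : ∑ u ∈ U, A u = ∑ g ∈ s, x g ^ 2 :=
    Finset.sum_fiberwise_of_maps_to
      (fun g hg => Finset.mem_image_of_mem _ (Finset.mem_union_left _ hg)) _
  have hBs : ∑ w ∈ W, B w ≤ M := by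
    rw [hB, Finset.sum_sigma']
    refine le_trans (le_of_eq ?_) (hM ((W.sigma fun w => {v ∈ V | MulReduced v⁻¹ w}).image
      fun q => q.2⁻¹ * q.1))
    refine (Finset.sum_image (f := fun h => η h ^ 2) ?_).symm
    rintro ⟨w, v⟩ hq ⟨w', v'⟩ hq' he
    simp only [Finset.coe_sigma, Set.mem_sigma_iff, Finset.mem_coe, Finset.mem_filter] at hq hq'
    obtain ⟨h1, h2⟩ := hq.2.2.inj hq'.2.2 ((hVn _ hq.2.1).trans (hVn _ hq'.2.1).symm) he
    rw [inv_inj] at h1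
    subst h1 h2
    rfl
  calc ∑ h ∈ E, (∑ g ∈ s with CancelsAt p g h, x g * η (g⁻¹ * h)) ^ 2
      ≤ ∑ h ∈ E, A (takeWord p h) * B (dropWord p h) := Finset.sum_le_sum fun h _ => hrow h
    _ = ∑ q ∈ E.image fun h => (takeWord p h, dropWord p h), A q.1 * B q.2 := by
        rw [Finset.sum_image]
        intro h _ h' _ he
        obtain ⟨h1, h2⟩ := Prod.mk.inj he
        rw [← takeWord_mul_dropWord p h, ← takeWord_mul_dropWord p h', h1, h2]
    _ ≤ ∑ q ∈ U ×ˢ W, A q.1 * B q.2 := by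
        refine Finset.sum_le_sum_of_subset_of_nonneg ?_ fun _ _ _ => mul_nonneg (hA0 _) (hB0 _)
        intro q hq
        obtain ⟨h, hh, rfl⟩ := Finset.mem_image.1 hq
        exact Finset.mem_product.2 ⟨Finset.mem_image_of_mem _ (Finset.mem_union_right _ hh),
          Finset.mem_image_of_mem _ hh⟩
    _ = (∑ g ∈ s, x g ^ 2) * ∑ w ∈ W, B w := by
        rw [Finset.sum_product, ← hAs, Finset.sum_mul_sum]
    _ ≤ (∑ g ∈ s, x g ^ 2) * M :=
        mul_le_mul_of_nonneg_left hBs (Finset.sum_nonneg fun _ _ => sq_nonneg _)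

/-- **Haagerup's inequality** for convolution by a nonnegative function supported on the words of
length `k` of a free group. -/
theorem sum_sq_convolution_le (k : ℕ) (s E : Finset (FreeGroup S)) (hs : ∀ g ∈ s, g.norm = k)
    (x η : FreeGroup S → ℝ) (hx : ∀ g, 0 ≤ x g) (hη : ∀ g, 0 ≤ η g) (M : ℝ)
    (hM : ∀ F : Finset (FreeGroup S), ∑ h ∈ F, η h ^ 2 ≤ M) :
    ∑ h ∈ E, (∑ g ∈ s, x g * η (g⁻¹ * h)) ^ 2 ≤ ((k : ℝ) + 1) ^ 2 * ((∑ g ∈ s, x g ^ 2) * M) := by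
  classical
  have h0 : ∀ g h, 0 ≤ x g * η (g⁻¹ * h) := fun g h => mul_nonneg (hx _) (hη _)
  have hsplit : ∀ h, ∑ g ∈ s, x g * η (g⁻¹ * h) ≤
      ∑ p ∈ Finset.range (k + 1), ∑ g ∈ s with CancelsAt p g h, x g * η (g⁻¹ * h) := by
    intro h
    simp_rw [Finset.sum_filter]
    rw [Finset.sum_comm]
    refine Finset.sum_le_sum fun g hg => ?_
    obtain ⟨p, hp, hc⟩ := exists_cancelsAt g h
    rw [hs g hg] at hp
    refine le_trans (by rw [if_pos hc]) (Finset.single_le_sum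
      (f := fun p => if CancelsAt p g h then x g * η (g⁻¹ * h) else 0)
      (fun p _ => ?_) (Finset.mem_range_succ_iff.2 hp))
    split_ifs
    exacts [h0 g h, le_rfl]
  calc ∑ h ∈ E, (∑ g ∈ s, x g * η (g⁻¹ * h)) ^ 2
      ≤ ∑ h ∈ E, ((k : ℝ) + 1) * ∑ p ∈ Finset.range (k + 1),
          (∑ g ∈ s with CancelsAt p g h, x g * η (g⁻¹ * h)) ^ 2 := by
        refine Finset.sum_le_sum fun h _ => ?_
        refine (pow_le_pow_left₀ (Finset.sum_nonneg fun g _ => h0 g h) (hsplit h) 2).trans ?_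
        simpa using sq_sum_le_card_mul_sum_sq (s := Finset.range (k + 1))
          (f := fun p => ∑ g ∈ s with CancelsAt p g h, x g * η (g⁻¹ * h))
    _ = ((k : ℝ) + 1) * ∑ p ∈ Finset.range (k + 1), ∑ h ∈ E,
          (∑ g ∈ s with CancelsAt p g h, x g * η (g⁻¹ * h)) ^ 2 := by
        rw [← Finset.mul_sum, Finset.sum_comm]
    _ ≤ ((k : ℝ) + 1) * ∑ _p ∈ Finset.range (k + 1), (∑ g ∈ s, x g ^ 2) * M := by
        gcongr with p _
        exact sum_sq_cancelsAt_le p k s E hs x η M hM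
    _ = ((k : ℝ) + 1) ^ 2 * ((∑ g ∈ s, x g ^ 2) * M) := by
        rw [Finset.sum_const, Finset.card_range, nsmul_eq_mul]
        push_cast
        ring

end FreeGroup


/-- Haagerup's inequality for homogeneous elements in a reduced crossed product by a free
group: for any action `α` of the free group `F = FreeGroup S` by *-automorphisms on a
norm-closed self-adjoint subalgebra `A ⊆ B(H)`, any `k ≥ 0` and any finitely supported
`X : F → A` supported on words of length `k`, the operator `T_X` on `ℓ²(F,H)` (representing
`Σ_g L_g X(g)` in `C*_r(A ⋊_α F)`) satisfies
`‖T_X‖ ≤ (k+1)(Σ_{a∈C_k} ‖X(a)‖²)^{1/2}`. -/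
theorem free_group_Ck_norm_bound {S : Type*} [DecidableEq S]
    (H : Type*) [NormedAddCommGroup H] [InnerProductSpace ℂ H] [CompleteSpace H]
    (A : NonUnitalStarSubalgebra ℂ (H →L[ℂ] H))
    (hA : IsClosed (A : Set (H →L[ℂ] H)))
    (α : FreeGroup S → (A ≃⋆ₐ[ℂ] A)) (hα1 : ∀ x, α 1 x = x)
    (hαmul : ∀ g h x, α (g * h) x = α g (α h x))
    (k : ℕ) (X : FreeGroup S →₀ A)
    (hX : ∀ a ∈ X.support, a.norm = k)
    (T : lp (fun _ : FreeGroup S => H) 2 →L[ℂ] lp (fun _ : FreeGroup S => H) 2)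
    (hT : ∀ (ξ : lp (fun _ : FreeGroup S => H) 2) (h : FreeGroup S),
      (T ξ : ∀ _ : FreeGroup S, H) h = ∑ g ∈ X.support,
        ((α (h⁻¹ * g) (X g) : H →L[ℂ] H) ((ξ : ∀ _ : FreeGroup S, H) (g⁻¹ * h)))) :
    ‖T‖ ≤ ((k : ℝ) + 1) *
      Real.sqrt (∑ a ∈ X.support, ‖(X a : H →L[ℂ] H)‖ ^ 2) := by
  have : IsClosed (A : Set (H →L[ℂ] H)) := hA
  have hiso : ∀ g (a : A), ‖(α g a : H →L[ℂ] H)‖ = ‖(a : H →L[ℂ] H)‖ := fun g a =>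
    StarAlgEquiv.norm_map (α g) a
  have two : (0 : ℝ) < (2 : ENNReal).toReal := by norm_num
  refine T.opNorm_le_bound (by positivity) fun ξ => ?_
  refine lp.norm_le_of_forall_sum_le two (by positivity) fun E => ?_
  have key := FreeGroup.sum_sq_convolution_le k X.support E hX (fun g => ‖(X g : H →L[ℂ] H)‖)
    (fun h => ‖ξ h‖) (fun _ => norm_nonneg _) (fun _ => norm_nonneg _) (‖ξ‖ ^ 2)
    (fun F => by simpa using lp.sum_rpow_le_norm_rpow two ξ F)
  simp only [ENNReal.toReal_ofNat, Real.rpow_ofNat]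
  rw [mul_pow, mul_pow, Real.sq_sqrt (by positivity), mul_assoc]
  refine le_trans (Finset.sum_le_sum fun h _ => ?_) key
  refine pow_le_pow_left₀ (norm_nonneg _) ?_ 2
  rw [hT]
  refine norm_sum_le_of_le _ fun g _ => ?_
  exact (ContinuousLinearMap.le_opNorm _ _).trans_eq (by rw [hiso])
end

section
/- Let F be a free group on a set S, with word length |·|. Then for every complex Hilbert space H, every norm-closed self-adjoint subalgebra A of B(H), every action α of F on A by *-automorphisms, and every finitely supported X : F → A, one has ‖T_X‖ ≤ 2 ( Σ_{g∈F} (1+|g|)⁴ ‖X(g)‖² )^{1/2}. -/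
namespace FreeGroup

variable {S : Type*}

/-- Two reduced words split off a common prefix so that no cancellation remains between the
inverse of one remainder and the other remainder. -/
theorem IsReduced.exists_common_prefix {L₁ L₂ : List (S × Bool)} (h₁ : IsReduced L₁)
    (h₂ : IsReduced L₂) :
    ∃ a b c, L₁ = a ++ b ∧ L₂ = a ++ c ∧ IsReduced (invRev b ++ c) := by
  classical
  have hinv : ∀ {L : List (S × Bool)}, IsReduced L → IsReduced (invRev L) := fun h ↦ by
    rw [isReduced_iff_reduce_eq] at h ⊢
    rw [reduce_invRev, h]
  induction L₁ generalizing L₂ with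
  | nil => exact ⟨[], [], L₂, rfl, rfl, by simpa using h₂⟩
  | cons x L₁ ih =>
    cases L₂ with
    | nil => exact ⟨[], x :: L₁, [], rfl, rfl, by simpa using hinv h₁⟩
    | cons y L₂ =>
      by_cases hxy : x = y
      · subst hxy
        obtain ⟨a, b, c, rfl, rfl, h⟩ :=
          ih (h₁.infix (List.suffix_cons x L₁).isInfix) (h₂.infix (List.suffix_cons x L₂).isInfix)
        exact ⟨x :: a, b, c, rfl, rfl, h⟩
      · refine ⟨[], x :: L₁, y :: L₂, rfl, rfl, ?_⟩
        refine List.isChain_append.2 ⟨hinv h₁, h₂, ?_⟩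
        intro u hu v hv
        obtain ⟨x₁, x₂⟩ := x
        obtain ⟨y₁, y₂⟩ := y
        simp only [invRev, List.map_cons, List.reverse_cons, List.getLast?_append,
          List.getLast?_singleton, Option.some_or, Option.mem_def, Option.some.injEq,
          List.head?_cons] at hu hv
        subst hu hv
        intro h
        simp only at h
        subst h
        cases x₂ <;> cases y₂ <;> simp_all

variable [DecidableEq S]

/-- In the product `h = g * (g⁻¹ * h)`, some prefix of `g` survives as a prefix of `h`, and the rest
of `h` is the part of `g⁻¹ * h` left after cancelling the rest of `g`. -/
theorem exists_take_eq_drop_eq (g h : FreeGroup S) :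
    ∃ j ≤ g.norm, g.toWord.take j = h.toWord.take j ∧
      (g⁻¹ * h).toWord.drop (g.norm - j) = h.toWord.drop j := by
  obtain ⟨a, b, c, hg, hh, hr⟩ :=
    (isReduced_toWord (x := g)).exists_common_prefix (isReduced_toWord (x := h))
  have hk : (g⁻¹ * h).toWord = invRev b ++ c := by
    have : g⁻¹ * h = mk (invRev b ++ c) := by
      rw [← mk_toWord (x := g), ← mk_toWord (x := h), hg, hh, ← mul_mk, ← mul_mk, ← mul_mk,
        ← inv_mk]
      group
    rw [this, toWord_mk, hr.reduce_eq]
  have hn : g.norm = a.length + b.length := by simp [norm, hg]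
  refine ⟨a.length, by lia, by simp [hg, hh], ?_⟩
  have : g.norm - a.length = (invRev b).length := by simp [hn]
  rw [this, hk, hh, List.drop_left, List.drop_left]

end FreeGroup

/-- A Cauchy-Schwarz bound for a convolution restricted to pairs `(g, h)` with `t g = t h` and
`d' (g⁻¹ * h) = d h`, when `h` is determined by `(t h, d h)`. -/
theorem sum_sq_restricted_convolution_le {Γ β γ : Type*} [Group Γ] [DecidableEq Γ]
    [DecidableEq β] [DecidableEq γ] (t : Γ → β) (d d' : Γ → γ)
    (htd : ∀ h h', t h = t h' → d h = d h' → h = h') (G s : Finset Γ) (f φ : Γ → ℝ) {B : ℝ}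
    (hB : ∀ K : Finset Γ, ∑ k ∈ K, φ k ^ 2 ≤ B) :
    ∑ h ∈ s, (∑ g ∈ G with t g = t h ∧ d' (g⁻¹ * h) = d h, f g * φ (g⁻¹ * h)) ^ 2
      ≤ (∑ g ∈ G, f g ^ 2) * B := by
  set K : Finset Γ := (G ×ˢ s).image fun p ↦ p.1⁻¹ * p.2
  have hpoint : ∀ h ∈ s,
      (∑ g ∈ G with t g = t h ∧ d' (g⁻¹ * h) = d h, f g * φ (g⁻¹ * h)) ^ 2
        ≤ ∑ g ∈ G, ∑ k ∈ K, if t g = t h ∧ d' k = d h then f g ^ 2 * φ k ^ 2 else 0 := by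
    intro h hh
    have h1 : ∑ g ∈ G with t g = t h ∧ d' (g⁻¹ * h) = d h, f g ^ 2
        ≤ ∑ g ∈ G with t g = t h, f g ^ 2 :=
      Finset.sum_le_sum_of_subset_of_nonneg
        (fun g hg ↦ by simp only [Finset.mem_filter] at hg ⊢; tauto) fun _ _ _ ↦ sq_nonneg _
    have h2 : ∑ g ∈ G with t g = t h ∧ d' (g⁻¹ * h) = d h, φ (g⁻¹ * h) ^ 2
        ≤ ∑ k ∈ K with d' k = d h, φ k ^ 2 := by
      rw [← Finset.sum_image (f := fun k ↦ φ k ^ 2) (g := fun g ↦ g⁻¹ * h)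
        (fun x _ y _ hxy ↦ by simpa using hxy)]
      refine Finset.sum_le_sum_of_subset_of_nonneg ?_ fun _ _ _ ↦ sq_nonneg _
      intro k hk
      simp only [Finset.mem_image, Finset.mem_filter] at hk
      obtain ⟨g, ⟨hg, -, hd⟩, rfl⟩ := hk
      exact Finset.mem_filter.2
        ⟨Finset.mem_image.2 ⟨(g, h), Finset.mem_product.2 ⟨hg, hh⟩, rfl⟩, hd⟩
    calc _ ≤ _ := Finset.sum_mul_sq_le_sq_mul_sq _ _ _
      _ ≤ (∑ g ∈ G with t g = t h, f g ^ 2) * ∑ k ∈ K with d' k = d h, φ k ^ 2 :=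
        mul_le_mul h1 h2 (Finset.sum_nonneg fun _ _ ↦ sq_nonneg _)
          (Finset.sum_nonneg fun _ _ ↦ sq_nonneg _)
      _ = _ := by
        rw [Finset.sum_mul_sum, Finset.sum_filter]
        refine Finset.sum_congr rfl fun g _ ↦ ?_
        by_cases hg : t g = t h <;> simp [hg, Finset.sum_filter]
  calc _ ≤ ∑ h ∈ s, ∑ g ∈ G, ∑ k ∈ K,
          if t g = t h ∧ d' k = d h then f g ^ 2 * φ k ^ 2 else 0 := Finset.sum_le_sum hpoint
    _ = ∑ g ∈ G, ∑ k ∈ K, ∑ h ∈ s,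
          if t g = t h ∧ d' k = d h then f g ^ 2 * φ k ^ 2 else 0 := by
      rw [Finset.sum_comm]
      exact Finset.sum_congr rfl fun _ _ ↦ Finset.sum_comm
    _ ≤ ∑ g ∈ G, ∑ k ∈ K, f g ^ 2 * φ k ^ 2 := by
      refine Finset.sum_le_sum fun g _ ↦ Finset.sum_le_sum fun k _ ↦ ?_
      rw [← Finset.sum_filter, Finset.sum_const, nsmul_eq_mul]
      have hc : (s.filter fun h ↦ t g = t h ∧ d' k = d h).card ≤ 1 :=
        Finset.card_le_one.2 fun a ha b hb ↦ by
          simp only [Finset.mem_filter] at ha hb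
          exact htd a b (ha.2.1.symm.trans hb.2.1) (ha.2.2.symm.trans hb.2.2)
      exact mul_le_of_le_one_left (by positivity) (by exact_mod_cast hc)
    _ = (∑ g ∈ G, f g ^ 2) * ∑ k ∈ K, φ k ^ 2 := (Finset.sum_mul_sum ..).symm
    _ ≤ _ := mul_le_mul_of_nonneg_left (hB K) (Finset.sum_nonneg fun _ _ ↦ sq_nonneg _)

/-- The partial sums of `∑ 1 / (n + 1) ^ 2` are at most `2`. -/
theorem sum_range_inv_succ_sq_le_two (N : ℕ) :
    ∑ n ∈ Finset.range N, (((n : ℝ) + 1) ^ 2)⁻¹ ≤ 2 := by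
  have h : ∑ n ∈ Finset.range (N + 1), (((n : ℝ) + 1) ^ 2)⁻¹ ≤ 2 - ((N : ℝ) + 1)⁻¹ := by
    induction N with
    | zero => norm_num
    | succ N ih =>
      rw [Finset.sum_range_succ]
      have : (((N : ℝ) + 1 + 1) ^ 2)⁻¹ ≤ ((N : ℝ) + 1)⁻¹ - ((N : ℝ) + 1 + 1)⁻¹ := by
        rw [inv_sub_inv (by positivity) (by positivity), add_sub_cancel_left, ← one_div]
        gcongr
        nlinarith
      push_cast
      linarith
  rw [Finset.sum_range_succ] at h
  have h₁ : (0 : ℝ) ≤ ((N : ℝ) + 1)⁻¹ := by positivity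
  have h₂ : (0 : ℝ) ≤ (((N : ℝ) + 1) ^ 2)⁻¹ := by positivity
  linarith

/-- Haagerup's inequality for convolution by a finitely supported function on a free group. -/
theorem FreeGroup.sum_sq_convolution_le_s10 {S : Type*} [DecidableEq S] (G s : Finset (FreeGroup S))
    (f φ : FreeGroup S → ℝ) (hf : ∀ g, 0 ≤ f g) (hφ : ∀ g, 0 ≤ φ g) {B : ℝ}
    (hB : ∀ K : Finset (FreeGroup S), ∑ k ∈ K, φ k ^ 2 ≤ B) :
    ∑ h ∈ s, (∑ g ∈ G, f g * φ (g⁻¹ * h)) ^ 2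
      ≤ 4 * (∑ g ∈ G, (1 + (g.norm : ℝ)) ^ 4 * f g ^ 2) * B := by
  set N := G.sup FreeGroup.norm + 1
  have hnorm : ∀ g ∈ G, g.norm ∈ Finset.range N := fun g hg ↦
    Finset.mem_range.2 (Nat.lt_succ_of_le (Finset.le_sup hg))
  let I : Finset ((_ : ℕ) × ℕ) := (Finset.range N).sigma fun n ↦ Finset.range (n + 1)
  let x (i : (_ : ℕ) × ℕ) (h : FreeGroup S) : ℝ :=
    ∑ g ∈ (G.filter fun g ↦ g.norm = i.1) with g.toWord.take i.2 = h.toWord.take i.2 ∧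
      (g⁻¹ * h).toWord.drop (i.1 - i.2) = h.toWord.drop i.2, f g * φ (g⁻¹ * h)
  have hx : ∀ i, ∑ h ∈ s, x i h ^ 2 ≤ (∑ g ∈ G with g.norm = i.1, f g ^ 2) * B := by
    intro i
    have htd : ∀ h h' : FreeGroup S, h.toWord.take i.2 = h'.toWord.take i.2 →
        h.toWord.drop i.2 = h'.toWord.drop i.2 → h = h' := fun h h' ht hd ↦ by
      rw [← FreeGroup.toWord_inj, ← List.take_append_drop i.2 h.toWord, ht, hd,
        List.take_append_drop]
    convert sum_sq_restricted_convolution_le (fun g ↦ g.toWord.take i.2)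
      (fun g ↦ g.toWord.drop i.2) (fun g ↦ g.toWord.drop (i.1 - i.2)) htd
      (G.filter fun g ↦ g.norm = i.1) s f φ hB
  have hdecomp : ∀ h, ∑ g ∈ G, f g * φ (g⁻¹ * h) ≤ ∑ i ∈ I, x i h := by
    intro h
    rw [← Finset.sum_fiberwise_of_maps_to hnorm, Finset.sum_sigma]
    refine Finset.sum_le_sum fun n _ ↦ ?_
    simp only [x]
    simp_rw [Finset.sum_filter (s := G.filter _)]
    rw [Finset.sum_comm]
    refine Finset.sum_le_sum fun g hg ↦ ?_
    obtain ⟨j, hj, ht, hd⟩ := FreeGroup.exists_take_eq_drop_eq g h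
    rw [(Finset.mem_filter.1 hg).2] at hj hd
    have hnn : 0 ≤ f g * φ (g⁻¹ * h) := mul_nonneg (hf _) (hφ _)
    calc f g * φ (g⁻¹ * h)
        = if g.toWord.take j = h.toWord.take j ∧
            (g⁻¹ * h).toWord.drop (n - j) = h.toWord.drop j then f g * φ (g⁻¹ * h) else 0 := by
          rw [if_pos ⟨ht, hd⟩]
      _ ≤ _ := Finset.single_le_sum (f := fun j ↦ if g.toWord.take j = h.toWord.take j ∧
            (g⁻¹ * h).toWord.drop (n - j) = h.toWord.drop j then f g * φ (g⁻¹ * h) else 0)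
          (fun j _ ↦ by split_ifs <;> simp [hnn])
          (Finset.mem_range.2 (Nat.lt_succ_of_le hj))
  have hw : ∑ i ∈ I, (((i.1 : ℝ) + 1) ^ 3)⁻¹ ≤ 2 := by
    rw [Finset.sum_sigma]
    have hterm : ∀ n ∈ Finset.range N, ∑ _j ∈ Finset.range (n + 1), (((n : ℝ) + 1) ^ 3)⁻¹
        = (((n : ℝ) + 1) ^ 2)⁻¹ := fun n _ ↦ by
      simp only [Finset.sum_const, Finset.card_range, nsmul_eq_mul]
      push_cast
      field_simp
    rw [Finset.sum_congr rfl hterm]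
    exact sum_range_inv_succ_sq_le_two N
  have hpoint : ∀ h, (∑ g ∈ G, f g * φ (g⁻¹ * h)) ^ 2
      ≤ 2 * ∑ i ∈ I, ((i.1 : ℝ) + 1) ^ 3 * x i h ^ 2 := by
    intro h
    calc _ ≤ (∑ i ∈ I, x i h) ^ 2 :=
        pow_le_pow_left₀ (Finset.sum_nonneg fun g _ ↦ mul_nonneg (hf _) (hφ _)) (hdecomp h) 2
      _ ≤ (∑ i ∈ I, (((i.1 : ℝ) + 1) ^ 3)⁻¹) * ∑ i ∈ I, ((i.1 : ℝ) + 1) ^ 3 * x i h ^ 2 :=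
        Finset.sum_sq_le_sum_mul_sum_of_sq_le_mul _ (fun _ _ ↦ by positivity)
          (fun _ _ ↦ by positivity) fun _ _ ↦ le_of_eq (by field_simp)
      _ ≤ _ := mul_le_mul_of_nonneg_right hw (Finset.sum_nonneg fun _ _ ↦ by positivity)
  have hB0 : 0 ≤ B := by simpa using hB ∅
  calc _ ≤ ∑ h ∈ s, 2 * ∑ i ∈ I, ((i.1 : ℝ) + 1) ^ 3 * x i h ^ 2 :=
      Finset.sum_le_sum fun h _ ↦ hpoint h
    _ = 2 * ∑ i ∈ I, ((i.1 : ℝ) + 1) ^ 3 * ∑ h ∈ s, x i h ^ 2 := by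
      rw [← Finset.mul_sum, Finset.sum_comm]
      simp_rw [Finset.mul_sum]
    _ ≤ 2 * ∑ i ∈ I, ((i.1 : ℝ) + 1) ^ 3 * ((∑ g ∈ G with g.norm = i.1, f g ^ 2) * B) := by
      gcongr with i
      exact hx i
    _ = 2 * (∑ g ∈ G, (1 + (g.norm : ℝ)) ^ 4 * f g ^ 2) * B := by
      have hfiber : ∀ n, ∑ g ∈ G with g.norm = n, (1 + (g.norm : ℝ)) ^ 4 * f g ^ 2
          = (1 + (n : ℝ)) ^ 4 * ∑ g ∈ G with g.norm = n, f g ^ 2 := fun n ↦ by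
        rw [Finset.mul_sum]
        refine Finset.sum_congr rfl fun g hg ↦ ?_
        rw [(Finset.mem_filter.1 hg).2]
      have hsum : ∑ g ∈ G, (1 + (g.norm : ℝ)) ^ 4 * f g ^ 2
          = ∑ n ∈ Finset.range N, (1 + (n : ℝ)) ^ 4 * ∑ g ∈ G with g.norm = n, f g ^ 2 := by
        rw [← Finset.sum_fiberwise_of_maps_to hnorm]
        exact Finset.sum_congr rfl fun n _ ↦ hfiber n
      rw [hsum, Finset.sum_sigma, mul_assoc, Finset.sum_mul]
      congr 1
      refine Finset.sum_congr rfl fun n _ ↦ ?_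
      simp only [Finset.sum_const, Finset.card_range, nsmul_eq_mul]
      push_cast
      ring
    _ ≤ _ := by
      gcongr
      norm_num

/-- Haagerup's inequality for reduced crossed products by a free group: for any action `α` of
`F = FreeGroup S` by *-automorphisms on a norm-closed self-adjoint subalgebra `A ⊆ B(H)` and
any finitely supported `X : F → A`, the operator `T_X` on `ℓ²(F,H)` (representing
`Σ_g L_g X(g)` in `C*_r(A ⋊_α F)`) satisfies
`‖T_X‖ ≤ 2 (Σ_g (1+|g|)⁴ ‖X(g)‖²)^{1/2}`, with `|g|` the word length. -/
theorem free_group_complete_scalar_rapid_decay {S : Type*} [DecidableEq S]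
    (H : Type*) [NormedAddCommGroup H] [InnerProductSpace ℂ H] [CompleteSpace H]
    (A : NonUnitalStarSubalgebra ℂ (H →L[ℂ] H))
    (hA : IsClosed (A : Set (H →L[ℂ] H)))
    (α : FreeGroup S → (A ≃⋆ₐ[ℂ] A)) (hα1 : ∀ x, α 1 x = x)
    (hαmul : ∀ g h x, α (g * h) x = α g (α h x))
    (X : FreeGroup S →₀ A)
    (T : lp (fun _ : FreeGroup S => H) 2 →L[ℂ] lp (fun _ : FreeGroup S => H) 2)
    (hT : ∀ (ξ : lp (fun _ : FreeGroup S => H) 2) (h : FreeGroup S),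
      (T ξ : ∀ _ : FreeGroup S, H) h = ∑ g ∈ X.support,
        ((α (h⁻¹ * g) (X g) : H →L[ℂ] H) ((ξ : ∀ _ : FreeGroup S, H) (g⁻¹ * h)))) :
    ‖T‖ ≤ 2 * Real.sqrt (∑ g ∈ X.support,
        (1 + (g.norm : ℝ)) ^ 4 * ‖(X g : H →L[ℂ] H)‖ ^ 2) := by
  have hiso : ∀ g x, ‖(α g x : H →L[ℂ] H)‖ ≤ ‖(x : H →L[ℂ] H)‖ := fun g x ↦ by
    have : IsClosed (A : Set (H →L[ℂ] H)) := hA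
    exact NonUnitalStarAlgHom.norm_apply_le (α g) x
  refine T.opNorm_le_bound (by positivity) fun ξ ↦ ?_
  have h2 : (2 : ENNReal).toReal = 2 := by simp
  have hB : ∀ K : Finset (FreeGroup S), ∑ k ∈ K, ‖ξ k‖ ^ 2 ≤ ‖ξ‖ ^ 2 := fun K ↦ by
    have := lp.sum_rpow_le_norm_rpow (p := 2) (by simp) ξ K
    rw [h2] at this
    exact_mod_cast this
  refine lp.norm_le_of_forall_sum_le (by simp) (by positivity) fun s ↦ ?_
  rw [h2]
  norm_cast
  have hpoint : ∀ h, ‖T ξ h‖ ≤ ∑ g ∈ X.support, ‖(X g : H →L[ℂ] H)‖ * ‖ξ (g⁻¹ * h)‖ := fun h ↦ by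
    rw [hT]
    refine (norm_sum_le _ _).trans (Finset.sum_le_sum fun g _ ↦ ?_)
    exact (ContinuousLinearMap.le_opNorm _ _).trans
      (mul_le_mul_of_nonneg_right (hiso _ _) (norm_nonneg _))
  calc ∑ h ∈ s, ‖T ξ h‖ ^ 2
      ≤ ∑ h ∈ s, (∑ g ∈ X.support, ‖(X g : H →L[ℂ] H)‖ * ‖ξ (g⁻¹ * h)‖) ^ 2 :=
        Finset.sum_le_sum fun h _ ↦ pow_le_pow_left₀ (norm_nonneg _) (hpoint h) 2
    _ ≤ _ := FreeGroup.sum_sq_convolution_le_s10 X.support s (fun g ↦ ‖(X g : H →L[ℂ] H)‖)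
        (fun k ↦ ‖ξ k‖) (fun _ ↦ norm_nonneg _) (fun _ ↦ norm_nonneg _) hB
    _ = _ := by
      rw [mul_pow, mul_pow, Real.sq_sqrt (Finset.sum_nonneg fun _ _ ↦ by positivity)]
      norm_num
end

section
/- Let G be a discrete group with a length function |·|, and fix a complex Hilbert space H, a norm-closed self-adjoint subalgebra A of B(H), and an action α of G on A by *-automorphisms. Assume there exist constants C > 0 and s > 0 such that every finitely supported X : G → A satisfies ‖T_X‖ ≤ C ‖ Σ_{g∈G} (1+|g|)^{2s} ( α_g(X(g) X(g)*) + X(g)* X(g) ) ‖^{1/2} (operator rapid decay; the norm on the right is taken in B(H)). Let φ : G → ℂ be a function with m := sup_{g∈G} |φ(g)| (2+|g|)^{s+1} < ∞. Then for every finitely supported X : G → A one has ‖T_{φ·X}‖ ≤ 2 C m ‖T_X‖, where φ·X : G → A is the finitely supported function (φ·X)(g) = φ(g) X(g); in particular, the multiplier M_φ extends to a bounded map on C*_r(A ⋊_α G) of norm at most 2Cm. -/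
open scoped InnerProductSpace ComplexOrder

/-- The sum of the squared norms of finitely many coordinates of an `ℓ²` vector is at most its
squared norm. -/
theorem lp_sum_sq_norm_le {ι H : Type*} [NormedAddCommGroup H]
    (f : lp (fun _ : ι => H) 2) (F : Finset ι) :
    ∑ i ∈ F, ‖(f : ∀ _ : ι, H) i‖ ^ 2 ≤ ‖f‖ ^ 2 := by
  have h := lp.sum_rpow_le_norm_rpow (p := 2) (by norm_num) f F
  simpa using h

section CrossedProduct

variable {G : Type*} [Group G] {H : Type*} [NormedAddCommGroup H] [InnerProductSpace ℂ H]

/-- `IsCrossedConvolution α X T` says that `T` is the operator `T_X` on `ℓ²(G, H)`. -/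
def IsCrossedConvolution [CompleteSpace H] {A : NonUnitalStarSubalgebra ℂ (H →L[ℂ] H)}
    (α : G → (A ≃⋆ₐ[ℂ] A)) (X : G →₀ A)
    (T : lp (fun _ : G => H) 2 →L[ℂ] lp (fun _ : G => H) 2) : Prop :=
  ∀ (ξ : lp (fun _ : G => H) 2) (h : G),
    (T ξ : ∀ _ : G, H) h = ∑ g ∈ X.support,
      ((α (h⁻¹ * g) (X g) : H →L[ℂ] H) ((ξ : ∀ _ : G, H) (g⁻¹ * h)))

namespace IsCrossedConvolution

variable [CompleteSpace H] {A : NonUnitalStarSubalgebra ℂ (H →L[ℂ] H)}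
  {α : G → (A ≃⋆ₐ[ℂ] A)} {X : G →₀ A}
  {T : lp (fun _ : G => H) 2 →L[ℂ] lp (fun _ : G => H) 2}

theorem apply_single [DecidableEq G] (hT : IsCrossedConvolution α X T) (k h : G) (v : H) :
    (T (lp.single 2 k v) : ∀ _ : G, H) h = (α k⁻¹ (X (h * k⁻¹)) : H →L[ℂ] H) v := by
  rw [hT, Finset.sum_eq_single (h * k⁻¹)]
  · simp [mul_assoc]
  · intro g _ hg
    have hne : g⁻¹ * h ≠ k := by
      rintro rfl
      exact hg (by group)
    simp [Pi.single_eq_of_ne hne]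
  · intro h0
    simp [Finsupp.notMem_support_iff.mp h0]

theorem sum_sq_norm_apply_le (hT : IsCrossedConvolution α X T) (hα1 : ∀ x, α 1 x = x)
    (F : Finset G) (v : H) :
    ∑ g ∈ F, ‖(X g : H →L[ℂ] H) v‖ ^ 2 ≤ (‖T‖ * ‖v‖) ^ 2 := by
  classical
  have h1 := lp_sum_sq_norm_le (T (lp.single 2 (1 : G) v)) F
  simp only [hT.apply_single, inv_one, mul_one, hα1] at h1
  have h2 : ‖T (lp.single 2 (1 : G) v)‖ ≤ ‖T‖ * ‖v‖ := by
    have h3 := T.le_opNorm (lp.single 2 (1 : G) v)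
    rwa [lp.norm_single (by norm_num)] at h3
  exact h1.trans (by gcongr)

theorem sum_sq_norm_star_apply_le (hT : IsCrossedConvolution α X T) (F : Finset G) (v : H) :
    ∑ g ∈ F, ‖(star (α g (X g) : H →L[ℂ] H)) v‖ ^ 2 ≤ (‖T‖ * ‖v‖) ^ 2 := by
  classical
  set ζ := ContinuousLinearMap.adjoint T (lp.single 2 (1 : G) v) with hζ
  have hcoord : ∀ g : G, (ζ : ∀ _ : G, H) g⁻¹ = (star (α g (X g) : H →L[ℂ] H)) v := by
    intro g
    refine ext_inner_left ℂ fun w => ?_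
    refine (lp.inner_single_left (𝕜 := ℂ) g⁻¹ w ζ).symm.trans ?_
    rw [hζ, ContinuousLinearMap.adjoint_inner_right,
      lp.inner_single_right, hT.apply_single, ContinuousLinearMap.star_eq_adjoint,
      ContinuousLinearMap.adjoint_inner_right]
    simp
  have h1 := lp_sum_sq_norm_le ζ (F.map (Equiv.inv G).toEmbedding)
  simp only [Finset.sum_map, Equiv.coe_toEmbedding, Equiv.inv_apply, hcoord] at h1
  have h2 : ‖ζ‖ ≤ ‖T‖ * ‖v‖ := by
    have h3 := (ContinuousLinearMap.adjoint T).le_opNorm (lp.single 2 (1 : G) v)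
    rwa [lp.norm_single (by norm_num), LinearIsometryEquiv.norm_map] at h3
  exact h1.trans (by gcongr)

end IsCrossedConvolution

end CrossedProduct

/-- A finite nonnegative combination of operators `a a* + b* b` is bounded in norm by any bound on
its quadratic form. -/
theorem norm_sum_smul_mul_star_add_star_mul_le {H : Type*} [NormedAddCommGroup H]
    [InnerProductSpace ℂ H] [CompleteSpace H] {ι : Type*} (F : Finset ι) (c : ι → ℝ)
    (hc : ∀ i ∈ F, 0 ≤ c i) (a b : ι → H →L[ℂ] H) {K : ℝ} (hK : 0 ≤ K)
    (h : ∀ v : H, ∑ i ∈ F, c i * (‖star (a i) v‖ ^ 2 + ‖b i v‖ ^ 2) ≤ K * ‖v‖ ^ 2) :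
    ‖∑ i ∈ F, (c i : ℂ) • (a i * star (a i) + star (b i) * b i)‖ ≤ K := by
  have hpos : 0 ≤ ∑ i ∈ F, (c i : ℂ) • (a i * star (a i) + star (b i) * b i) :=
    Finset.sum_nonneg fun i hi => smul_nonneg (by exact_mod_cast hc i hi)
      (add_nonneg (mul_star_self_nonneg _) (star_mul_self_nonneg _))
  rw [CStarAlgebra.norm_le_iff_le_algebraMap _ hK hpos, ContinuousLinearMap.le_def,
    ContinuousLinearMap.isPositive_def]
  refine ⟨?_, fun v => ?_⟩
  · exact ((IsSelfAdjoint.algebraMap _ (.all K)).sub (.of_nonneg hpos)).isSymmetric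
  · have hterm : ∀ i, (⟪(a i * star (a i) + star (b i) * b i) v, v⟫_ℂ) =
        ((‖star (a i) v‖ ^ 2 + ‖b i v‖ ^ 2 : ℝ) : ℂ) := by
      intro i
      have h1 : ⟪a i (star (a i) v), v⟫_ℂ = ⟪star (a i) v, star (a i) v⟫_ℂ := by
        rw [ContinuousLinearMap.star_eq_adjoint, ContinuousLinearMap.adjoint_inner_right]
      have h2 : ⟪star (b i) (b i v), v⟫_ℂ = ⟪b i v, b i v⟫_ℂ := by
        rw [ContinuousLinearMap.star_eq_adjoint, ContinuousLinearMap.adjoint_inner_left]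
      simp only [add_apply, mul_apply_eq_comp, inner_add_left,
        h1, h2, inner_self_eq_norm_sq_to_K]
      push_cast
      rfl
    have hsum : ⟪(∑ i ∈ F, (c i : ℂ) • (a i * star (a i) + star (b i) * b i)) v, v⟫_ℂ =
        ((∑ i ∈ F, c i * (‖star (a i) v‖ ^ 2 + ‖b i v‖ ^ 2) : ℝ) : ℂ) := by
      rw [sum_apply, sum_inner, Complex.ofReal_sum]
      refine Finset.sum_congr rfl fun i _ => ?_
      rw [smul_apply, inner_smul_left, hterm, Complex.conj_ofReal,
        ← Complex.ofReal_mul]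
    have hscal : ⟪(algebraMap ℝ (H →L[ℂ] H) K) v, v⟫_ℂ = ((K * ‖v‖ ^ 2 : ℝ) : ℂ) := by
      rw [Algebra.algebraMap_eq_smul_one, smul_apply,
        one_apply_eq_self, ← Complex.coe_smul, inner_smul_left,
        inner_self_eq_norm_sq_to_K, Complex.conj_ofReal]
      push_cast
      rfl
    rw [ContinuousLinearMap.reApplyInnerSelf_apply, sub_apply,
      inner_sub_left, hsum, hscal, ← Complex.ofReal_sub]
    exact sub_nonneg.mpr (h v)

/-- If `t (2 + x) ^ (s + 1) ≤ m` with `t, x ≥ 0`, then `(1 + x) ^ (2 s) t ^ 2 ≤ (m / 2) ^ 2`. -/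
theorem one_add_rpow_mul_sq_le {x s t m : ℝ} (hx : 0 ≤ x) (hs : 0 ≤ s) (ht : 0 ≤ t)
    (h : t * (2 + x) ^ (s + 1) ≤ m) : (1 + x) ^ (2 * s) * t ^ 2 ≤ (m / 2) ^ 2 := by
  have h1 : (1 + x) ^ s * 2 ≤ (2 + x) ^ (s + 1) := by
    rw [Real.rpow_add_one (by linarith)]
    gcongr <;> linarith
  have h2 : (1 + x) ^ (2 * s) = ((1 + x) ^ s) ^ 2 := by
    rw [mul_comm, Real.rpow_mul (by linarith), Real.rpow_two]
  rw [h2, ← mul_pow]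
  have h3 : 0 ≤ (1 + x) ^ s := Real.rpow_nonneg (by linarith) _
  gcongr
  nlinarith [mul_le_mul_of_nonneg_left h1 ht]

/-- If the reduced crossed product `C*_r(A ⋊_α G)` has operator rapid decay with constants
`C, s` — i.e. `‖T_X‖ ≤ C ‖Σ_g (1+|g|)^{2s} (α_g(X(g)X(g)*) + X(g)*X(g))‖^{1/2}` for every
finitely supported `X : G → A` — and `φ : G → ℂ` satisfies
`|φ(g)|(2+|g|)^{s+1} ≤ m` for all `g`, then `‖T_{φ·X}‖ ≤ 2Cm‖T_X‖` for every finitely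
supported `X`; in particular the multiplier `M_φ` is bounded with norm at most `2Cm`. -/
theorem operator_rapid_decay_multiplier_bound {G : Type*} [Group G] (ℓ : G → ℝ)
    (hℓ : IsLengthFunction ℓ)
    {H : Type*} [NormedAddCommGroup H] [InnerProductSpace ℂ H] [CompleteSpace H]
    (A : NonUnitalStarSubalgebra ℂ (H →L[ℂ] H))
    (hA : IsClosed (A : Set (H →L[ℂ] H)))
    (α : G → (A ≃⋆ₐ[ℂ] A)) (hα1 : ∀ x, α 1 x = x)
    (hαmul : ∀ g h x, α (g * h) x = α g (α h x))
    (C s : ℝ) (hC : 0 < C) (hs : 0 < s)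
    (hRD : ∀ (X : G →₀ A) (T : lp (fun _ : G => H) 2 →L[ℂ] lp (fun _ : G => H) 2),
      (∀ (ξ : lp (fun _ : G => H) 2) (h : G),
        (T ξ : ∀ _ : G, H) h = ∑ g ∈ X.support,
          ((α (h⁻¹ * g) (X g) : H →L[ℂ] H) ((ξ : ∀ _ : G, H) (g⁻¹ * h)))) →
      ‖T‖ ≤ C * Real.sqrt ‖∑ g ∈ X.support,
          ((((1 + ℓ g) ^ (2 * s) : ℝ) : ℂ) •
            ((α g (X g * star (X g)) : H →L[ℂ] H) +
              ((star (X g) * X g : A) : H →L[ℂ] H)))‖)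
    (φ : G → ℂ) (m : ℝ) (hm : ∀ g : G, ‖φ g‖ * (2 + ℓ g) ^ (s + 1) ≤ m)
    (X Y : G →₀ A) (hY : ∀ g : G, Y g = φ g • X g)
    (TX TY : lp (fun _ : G => H) 2 →L[ℂ] lp (fun _ : G => H) 2)
    (hTX : ∀ (ξ : lp (fun _ : G => H) 2) (h : G),
      (TX ξ : ∀ _ : G, H) h = ∑ g ∈ X.support,
        ((α (h⁻¹ * g) (X g) : H →L[ℂ] H) ((ξ : ∀ _ : G, H) (g⁻¹ * h))))
    (hTY : ∀ (ξ : lp (fun _ : G => H) 2) (h : G),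
      (TY ξ : ∀ _ : G, H) h = ∑ g ∈ Y.support,
        ((α (h⁻¹ * g) (Y g) : H →L[ℂ] H) ((ξ : ∀ _ : G, H) (g⁻¹ * h)))) :
    ‖TY‖ ≤ 2 * C * m * ‖TX‖ := by
  have hm0 : 0 ≤ m := le_trans
    (mul_nonneg (norm_nonneg _) (Real.rpow_nonneg (by linarith [hℓ.nonneg 1]) _)) (hm 1)
  have hX : IsCrossedConvolution α X TX := hTX
  have hnorm : ‖∑ g ∈ Y.support, ((((1 + ℓ g) ^ (2 * s) : ℝ) : ℂ) •
      ((α g (Y g * star (Y g)) : H →L[ℂ] H) + ((star (Y g) * Y g : A) : H →L[ℂ] H)))‖ ≤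
      (m * ‖TX‖) ^ 2 := by
    have hmap : ∀ g, (α g (Y g * star (Y g)) : H →L[ℂ] H) =
        (α g (Y g) : H →L[ℂ] H) * star (α g (Y g) : H →L[ℂ] H) := by
      intro g
      rw [map_mul, show α g (star (Y g)) = star (α g (Y g)) from (α g).map_star' _]
      rfl
    simp only [hmap]
    refine norm_sum_smul_mul_star_add_star_mul_le Y.support (fun g => (1 + ℓ g) ^ (2 * s))
      (fun g _ => Real.rpow_nonneg (by linarith [hℓ.nonneg g]) _)
      (fun g => (α g (Y g) : H →L[ℂ] H)) (fun g => (Y g : H →L[ℂ] H)) (sq_nonneg _) fun v => ?_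
    have hterm : ∀ g ∈ Y.support, (1 + ℓ g) ^ (2 * s) *
        (‖star (α g (Y g) : H →L[ℂ] H) v‖ ^ 2 + ‖(Y g : H →L[ℂ] H) v‖ ^ 2) ≤
        (m / 2) ^ 2 * (‖star (α g (X g) : H →L[ℂ] H) v‖ ^ 2 + ‖(X g : H →L[ℂ] H) v‖ ^ 2) := by
      intro g _
      have h1 : ‖star (α g (Y g) : H →L[ℂ] H) v‖ =
          ‖φ g‖ * ‖star (α g (X g) : H →L[ℂ] H) v‖ := by
        rw [hY, map_smul]
        simp [star_smul, norm_smul]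
      have h2 : ‖(Y g : H →L[ℂ] H) v‖ = ‖φ g‖ * ‖(X g : H →L[ℂ] H) v‖ := by
        rw [hY]
        simp [norm_smul]
      rw [h1, h2, mul_pow, mul_pow, ← mul_add, ← mul_assoc]
      gcongr
      exact one_add_rpow_mul_sq_le (hℓ.nonneg g) hs.le (norm_nonneg _) (hm g)
    refine (Finset.sum_le_sum hterm).trans ?_
    rw [← Finset.mul_sum, Finset.sum_add_distrib]
    have h1 := hX.sum_sq_norm_star_apply_le Y.support v
    have h2 := hX.sum_sq_norm_apply_le hα1 Y.support v
    nlinarith [mul_le_mul_of_nonneg_left (add_le_add h1 h2) (sq_nonneg (m / 2)),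
      sq_nonneg (m * (‖TX‖ * ‖v‖))]
  calc ‖TY‖ ≤ C * (m * ‖TX‖) := by
        refine (hRD Y TY hTY).trans ?_
        gcongr
        exact Real.sqrt_le_iff.mpr ⟨by positivity, hnorm⟩
    _ ≤ 2 * C * m * ‖TX‖ := by
        have : 0 ≤ C * (m * ‖TX‖) := by positivity
        linarith
end
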